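/- For every integer n ≥ d, the d* × d* matrix 𝒦_{n−1}(𝒞,𝒞), whose rows and columns are indexed by the pairs of I₊ and whose entry in row (i,ℓ) and column (j,k) is K_{n−1}^{(ℓ,k)}(c_i,c_j) = Σ_{ν=0}^{n−1} P_ν^{(ℓ)}(c_i) P_ν^{(k)}(c_j) / ‖P_ν‖_μ², is symmetric positive definite; consequently, if ℒ denotes the d* × d* diagonal matrix with diagonal entries λ_{j,k}, (j,k) ∈ I₊, the matrix I_{d*} + 𝒦_{n−1}(𝒞,𝒞)ℒ is nonsingular. -/

import Mathlib

open Polynomial MeasureTheory Finset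

noncomputable section

/-- The `k`-th derivative of a real polynomial. -/
def iterDeriv (k : ℕ) (f : Polynomial ℝ) : Polynomial ℝ := Polynomial.derivative^[k] f

/-- The support of a Borel measure on `ℝ`. -/
def measSupport (μ : Measure ℝ) : Set ℝ :=
  {x | ∀ ε > 0, 0 < μ (Set.Ioo (x - ε) (x + ε))}

/-- The discrete Sobolev-type inner product
`⟨f,g⟩_S = ∫ f g dμ + ∑_{j=1}^N ∑_{k=0}^{d_j} λ_{j,k} f^{(k)}(c_j) g^{(k)}(c_j)`. -/
def sobolevIP (μ : Measure ℝ) {N : ℕ} (c : Fin N → ℝ) (dd : Fin N → ℕ)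
    (lam : Fin N → ℕ → ℝ) (f g : Polynomial ℝ) : ℝ :=
  (∫ x, f.eval x * g.eval x ∂μ) +
    ∑ j : Fin N, ∑ k ∈ Finset.range (dd j + 1),
      lam j k * (iterDeriv k f).eval (c j) * (iterDeriv k g).eval (c j)

theorem integrable_polynomial_eval {μ : Measure ℝ} (hmom : ∀ m : ℕ, Integrable (fun x => x ^ m) μ)
    (f : Polynomial ℝ) : Integrable (fun x => f.eval x) μ := by
  simp_rw [Polynomial.eval_eq_sum_range]
  exact integrable_finsetSum _ fun m _ => (hmom m).const_mul _

/-- A nonzero polynomial has positive `L²` norm for a measure with infinite support. -/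
theorem integral_eval_sq_pos {μ : Measure ℝ} (hmom : ∀ m : ℕ, Integrable (fun x => x ^ m) μ)
    (hsupp : (measSupport μ).Infinite) {f : Polynomial ℝ} (hf : f ≠ 0) :
    0 < ∫ x, (f.eval x) ^ 2 ∂μ := by
  refine lt_of_le_of_ne (integral_nonneg fun x => sq_nonneg _) fun h0 => ?_
  have hint : Integrable (fun x => (f.eval x) ^ 2) μ := by
    simp_rw [← Polynomial.eval_pow]
    exact integrable_polynomial_eval hmom (f ^ 2)
  have hae := (integral_eq_zero_iff_of_nonneg (fun x => sq_nonneg (f.eval x)) hint).1 h0.symm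
  refine hsupp ((f.roots.toFinset.finite_toSet).subset fun x hx => ?_)
  by_contra hroot
  have hx0 : f.eval x ≠ 0 := by simpa [hf] using hroot
  have hopen : IsOpen {y | f.eval y ≠ 0} := isOpen_ne_fun f.continuous continuous_const
  obtain ⟨ε, hε, hball⟩ := Metric.isOpen_iff.1 hopen x hx0
  rw [Real.ball_eq_Ioo] at hball
  refine (hx ε hε).ne' (measure_mono_null hball ?_)
  simpa [Filter.EventuallyEq, ae_iff] using hae

/-- A linear functional that vanishes on the first `n` members of a sequence of monic polynomials
of increasing degree vanishes on all polynomials of degree less than `n`. -/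
theorem map_eq_zero_of_degree_lt (P : ℕ → Polynomial ℝ) (hPm : ∀ m, (P m).Monic)
    (hPd : ∀ m, (P m).natDegree = m) (L : Polynomial ℝ →ₗ[ℝ] ℝ) (n : ℕ)
    (hL : ∀ ν < n, L (P ν) = 0) (f : Polynomial ℝ) (hf : f.degree < n) : L f = 0 := by
  induction n generalizing f with
  | zero =>
    have : f = 0 := by simpa [Polynomial.degree_lt_iff_coeff_zero, Polynomial.ext_iff] using hf
    simp [this]
  | succ n ih =>
    have hlt : (f - f.coeff n • P n).degree < n := by
      rw [Polynomial.degree_lt_iff_coeff_zero] at hf ⊢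
      intro m hm
      rcases hm.eq_or_lt with rfl | hm
      · have : (P n).coeff n = 1 := by simpa [hPd] using (hPm n).coeff_natDegree
        simp [this]
      · have : (P n).coeff m = 0 :=
          Polynomial.coeff_eq_zero_of_natDegree_lt (by rw [hPd]; exact hm)
        simp [this, hf m hm]
    have := ih (fun ν hν => hL ν (by omega)) _ hlt
    simpa [hL n (by omega)] using this

theorem eval_iterDeriv_eq_zero {f : Polynomial ℝ} (hf : f ≠ 0) {a : ℝ} {m k : ℕ} (hk : k < m)
    (hdvd : (X - C a) ^ m ∣ f) : (iterDeriv k f).eval a = 0 :=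
  Polynomial.isRoot_iterate_derivative_of_lt_rootMultiplicity
    (hk.trans_le ((Polynomial.le_rootMultiplicity_iff hf).2 hdvd))

/-- A polynomial of low degree whose derivatives of order at most `dd j` vanish at all nodes `c j`
with `j ≠ i`, and whose first nonvanishing derivative at `c i` has order `l`. -/
theorem exists_hermite_polynomial {N : ℕ} {c : Fin N → ℝ} (hc : Function.Injective c)
    (dd : Fin N → ℕ) (i : Fin N) (l : ℕ) (hl : l ≤ dd i) :
    ∃ f : Polynomial ℝ, f.degree < (∑ j, (dd j + 1) : ℕ) ∧
      (∀ j ≠ i, ∀ k ≤ dd j, (iterDeriv k f).eval (c j) = 0) ∧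
      (∀ k < l, (iterDeriv k f).eval (c i) = 0) ∧ (iterDeriv l f).eval (c i) ≠ 0 := by
  set g : Polynomial ℝ := ∏ j ∈ univ.erase i, (X - C (c j)) ^ (dd j + 1) with hg
  have hgm : g.Monic := monic_prod_of_monic _ _ fun j _ => (monic_X_sub_C _).pow _
  have hfm : ((X - C (c i)) ^ l * g).Monic := ((monic_X_sub_C _).pow _).mul hgm
  refine ⟨(X - C (c i)) ^ l * g, ?_, fun j hj k hk => ?_, fun k hk => ?_, fun h0 => ?_⟩
  · have hgd : g.natDegree = ∑ j ∈ univ.erase i, (dd j + 1) := by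
      rw [hg, natDegree_prod_of_monic _ _ fun j _ => (monic_X_sub_C _).pow _]
      simp
    rw [Polynomial.degree_eq_natDegree hfm.ne_zero,
      ((monic_X_sub_C (c i)).pow l).natDegree_mul hgm, hgd,
      ← Finset.add_sum_erase univ (fun j => dd j + 1) (mem_univ i)]
    simp only [natDegree_pow, natDegree_X_sub_C]
    exact_mod_cast (by omega)
  · exact eval_iterDeriv_eq_zero hfm.ne_zero (Nat.lt_succ_of_le hk)
      ((dvd_prod_of_mem _ (by simpa using hj)).mul_left _)
  · exact eval_iterDeriv_eq_zero hfm.ne_zero hk (dvd_mul_right _ _)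
  · have hmult : l < ((X - C (c i)) ^ l * g).rootMultiplicity (c i) := by
      refine (lt_rootMultiplicity_iff_isRoot_iterate_derivative hfm.ne_zero).2 fun m hm => ?_
      rcases hm.eq_or_lt with rfl | hm
      · exact h0
      · exact eval_iterDeriv_eq_zero hfm.ne_zero hm (dvd_mul_right _ _)
    have hdvd := (le_rootMultiplicity_iff hfm.ne_zero).1 hmult
    rw [Nat.succ_eq_add_one, pow_succ,
      mul_dvd_mul_iff_left (pow_ne_zero _ (X_sub_C_ne_zero _)), dvd_iff_isRoot, IsRoot.def, hg,
      eval_prod, prod_eq_zero_iff] at hdvd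
    obtain ⟨j, hj, hj0⟩ := hdvd
    have hij : i = j := by simpa [sub_eq_zero, hc.eq_iff] using hj0
    exact ne_of_mem_erase hj hij.symm

/-- Evaluation of the `k`-th derivative at a point, as a linear functional. -/
def evalIterDeriv (k : ℕ) (a : ℝ) : Polynomial ℝ →ₗ[ℝ] ℝ :=
  (Polynomial.leval a).comp (Polynomial.derivative ^ k)

theorem evalIterDeriv_apply (k : ℕ) (a : ℝ) (f : Polynomial ℝ) :
    evalIterDeriv k a f = (iterDeriv k f).eval a := by
  simp [evalIterDeriv, iterDeriv, Module.End.pow_apply]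

/-- The derivative evaluations at distinct nodes are linearly independent on polynomials of
degree less than the total number of conditions. -/
theorem eq_zero_of_sum_iterDeriv_eq_zero {N : ℕ} {c : Fin N → ℝ} (hc : Function.Injective c)
    (dd : Fin N → ℕ) (I : Finset (Fin N × ℕ)) (hI : ∀ p ∈ I, p.2 ≤ dd p.1) (x : ↥I → ℝ)
    (hx : ∀ f : Polynomial ℝ, f.degree < (∑ j, (dd j + 1) : ℕ) →
      ∑ p : ↥I, (iterDeriv p.1.2 f).eval (c p.1.1) * x p = 0) : x = 0 := by
  by_contra hne
  obtain ⟨p₀, hp₀⟩ := Function.ne_iff.1 hne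
  obtain ⟨p, hp, hmax⟩ := (univ.filter fun p => x p ≠ 0).exists_max_image (fun p => p.1.2)
    ⟨p₀, by simpa using hp₀⟩
  obtain ⟨f, hdeg, hoff, hlow, hval⟩ :=
    exists_hermite_polynomial hc dd p.1.1 p.1.2 (hI _ p.2)
  have hsum := hx f hdeg
  rw [Finset.sum_eq_single p _ (by simp)] at hsum
  · exact (mul_ne_zero hval (by simpa using hp)) hsum
  · intro q _ hqp
    by_cases hxq : x q = 0
    · simp [hxq]
    have hle : q.1.2 ≤ p.1.2 := hmax q (by simpa using hxq)
    by_cases hi : q.1.1 = p.1.1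
    · have hlt : q.1.2 < p.1.2 :=
        lt_of_le_of_ne hle fun h2 => hqp (Subtype.ext (Prod.ext hi h2))
      rw [hi, hlow _ hlt, zero_mul]
    · rw [hoff _ hi _ (hI _ q.2), zero_mul]

theorem det_one_add_mul_ne_zero {ι : Type*} [Fintype ι] [DecidableEq ι] {A B : Matrix ι ι ℝ}
    (hA : A.PosDef) (hB : B.PosDef) : (1 + A * B).det ≠ 0 := by
  have hfac : 1 + A * B = A * (A⁻¹ + B) := by
    rw [mul_add, Matrix.mul_nonsing_inv _ hA.det_pos.ne'.isUnit]
  rw [hfac, Matrix.det_mul]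
  exact (mul_pos hA.det_pos (hA.inv.add hB).det_pos).ne'

theorem stmt6 (μ : Measure ℝ) [IsFiniteMeasure μ]
    (hmom : ∀ m : ℕ, Integrable (fun x => x ^ m) μ)
    (hsupp : (measSupport μ).Infinite)
    (P : ℕ → Polynomial ℝ) (hPm : ∀ m, (P m).Monic) (hPd : ∀ m, (P m).natDegree = m)
    (hPo : ∀ m l, m ≠ l → ∫ x, (P m).eval x * (P l).eval x ∂μ = 0)
    (h : ℕ → ℝ) (hh : ∀ m, h m = ∫ x, ((P m).eval x) ^ 2 ∂μ)
    (N : ℕ) (hN : 1 ≤ N)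
    (c : Fin N → ℝ) (hc : Function.Injective c)
    (dd : Fin N → ℕ) (hdd : Monotone dd)
    (lam : Fin N → ℕ → ℝ) (hlam : ∀ j k, 0 ≤ lam j k) (hlamd : ∀ j, 0 < lam j (dd j))
    (d : ℕ) (hd : d = ∑ j, (dd j + 1))
    (Iplus : Finset (Fin N × ℕ))
    (hIplus : ∀ p : Fin N × ℕ, p ∈ Iplus ↔ p.2 ≤ dd p.1 ∧ 0 < lam p.1 p.2)
    (n : ℕ) (hn : d ≤ n)
    (K : Matrix ↥Iplus ↥Iplus ℝ)
    (hK : ∀ p q : ↥Iplus, K p q = ∑ ν ∈ Finset.range n,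
      (iterDeriv p.1.2 (P ν)).eval (c p.1.1) * (iterDeriv q.1.2 (P ν)).eval (c q.1.1) / h ν) :
    K.PosDef ∧
      (1 + K * Matrix.diagonal fun p : ↥Iplus => lam p.1.1 p.1.2).det ≠ 0 := by
  have hh0 : ∀ m, 0 < h m := fun m => by
    rw [hh]; exact integral_eval_sq_pos hmom hsupp (hPm m).ne_zero
  let B : Matrix (Fin n) ↥Iplus ℝ := fun ν p => (iterDeriv p.1.2 (P ν)).eval (c p.1.1)
  have hKB : K = B.conjTranspose * Matrix.diagonal (fun ν : Fin n => (h ν)⁻¹) * B := by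
    ext p q
    rw [hK, Finset.sum_range, Matrix.mul_apply]
    refine Finset.sum_congr rfl fun ν _ => ?_
    rw [Matrix.mul_diagonal, Matrix.conjTranspose_apply, star_trivial]
    simp only [B]
    ring
  have hinj : Function.Injective B.mulVec := by
    refine (injective_iff_map_eq_zero B.mulVecLin).2 fun x hx => ?_
    refine eq_zero_of_sum_iterDeriv_eq_zero hc dd Iplus (fun p hp => ((hIplus p).1 hp).1) x
      fun f hf => ?_
    have hL : ∀ g, (∑ p : ↥Iplus, x p • evalIterDeriv p.1.2 (c p.1.1)) g =
        ∑ p : ↥Iplus, (iterDeriv p.1.2 g).eval (c p.1.1) * x p := fun g => by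
      simp [evalIterDeriv_apply, mul_comm]
    rw [← hL]
    refine map_eq_zero_of_degree_lt P hPm hPd _ n (fun ν hν => ?_) f
      (hf.trans_le (by rw [← hd]; exact_mod_cast hn))
    rw [hL]
    exact congrFun hx ⟨ν, hν⟩
  have hKpos : K.PosDef := by
    rw [hKB]
    exact (Matrix.PosDef.diagonal fun ν : Fin n => inv_pos.2 (hh0 ν)).conjTranspose_mul_mul_same hinj
  exact ⟨hKpos, det_one_add_mul_ne_zero hKpos
    (Matrix.PosDef.diagonal fun p => ((hIplus p.1).1 p.2).2)⟩
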